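/- Fix γ ∈ ℝ, d ≥ 1, and finite set(s) R (and B) ⊂ ℝ^d, and suppose that there is a unique γ-minimal matching M of R (respectively, of R and B). Then there exists ε > 0 such that for all μ ∈ ℝ with |μ − γ| < ε, M is the unique μ-minimal matching. -/

import Mathlib

open Set

/-- The cost function `f_γ`. -/
noncomputable def fgam (γ x : ℝ) : ℝ :=
  if 0 < γ then x ^ γ else if γ = 0 then Real.log x else -(x ^ γ)

variable {α : Type*} [MetricSpace α]

/-- The length of an unordered pair of points. -/
noncomputable def edgeLen : Sym2 α → ℝ :=
  Sym2.lift ⟨fun x y => dist x y, fun x y => dist_comm x y⟩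

/-- `M` is a 1-colour (partial) matching of `R`. -/
def IsMatch1 (R : Set α) (M : Set (Sym2 α)) : Prop :=
  (∀ e ∈ M, ¬ e.IsDiag ∧ ∀ x ∈ e, x ∈ R) ∧
  (∀ e ∈ M, ∀ e' ∈ M, ∀ x : α, x ∈ e → x ∈ e' → e = e')

/-- `x` is matched in the 1-colour matching `M`. -/
def matched1 (M : Set (Sym2 α)) (x : α) : Prop := ∃ e ∈ M, x ∈ e

/-- Number of unmatched points of `R` in `M`. -/
noncomputable def unm1 (R : Set α) (M : Set (Sym2 α)) : ℕ :=
  {x ∈ R | ¬ matched1 M x}.ncard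

/-- The total cost of a 1-colour matching. -/
noncomputable def cost1 (f : ℝ → ℝ) (M : Set (Sym2 α)) : ℝ :=
  ∑ᶠ e ∈ M, f (edgeLen e)

/-- Lexicographic comparison of (number of unmatched points, cost). -/
def lexLe (u : ℕ) (c : ℝ) (u' : ℕ) (c' : ℝ) : Prop :=
  u < u' ∨ (u = u' ∧ c ≤ c')

/-- `M` is an `f`-minimal 1-colour matching of the finite set `R`. -/
def FinMin1 (f : ℝ → ℝ) (R : Set α) (M : Set (Sym2 α)) : Prop :=
  IsMatch1 R M ∧
  ∀ m : Set (Sym2 α), IsMatch1 R m →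
    lexLe (unm1 R M) (cost1 f M) (unm1 R m) (cost1 f m)

/-- `M` is a 2-colour (partial) matching of `R` and `B`. -/
def IsMatch2 (R B : Set α) (M : Set (α × α)) : Prop :=
  (∀ e ∈ M, e.1 ∈ R ∧ e.2 ∈ B) ∧
  (∀ x y y' : α, (x, y) ∈ M → (x, y') ∈ M → y = y') ∧
  (∀ x x' y : α, (x, y) ∈ M → (x', y) ∈ M → x = x')

/-- Number of unmatched points in a 2-colour matching. -/
noncomputable def unm2 (R B : Set α) (M : Set (α × α)) : ℕ :=
  {x ∈ R | ¬ ∃ y, (x, y) ∈ M}.ncard + {y ∈ B | ¬ ∃ x, (x, y) ∈ M}.ncard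

/-- The total cost of a 2-colour matching. -/
noncomputable def cost2 (f : ℝ → ℝ) (M : Set (α × α)) : ℝ :=
  ∑ᶠ e ∈ M, f (dist e.1 e.2)

/-- `M` is an `f`-minimal 2-colour matching of the finite sets `R`, `B`. -/
def FinMin2 (f : ℝ → ℝ) (R B : Set α) (M : Set (α × α)) : Prop :=
  IsMatch2 R B M ∧
  ∀ m : Set (α × α), IsMatch2 R B m →
    lexLe (unm2 R B M) (cost2 f M) (unm2 R B m) (cost2 f m)

/-- `R'` is compatible with the 1-colour matching `M`. -/
def Compat1 (M : Set (Sym2 α)) (R' : Set α) : Prop :=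
  ∀ e ∈ M, (∃ x ∈ e, x ∈ R') → ∀ y ∈ e, y ∈ R'

/-- Restriction of a 1-colour matching to a subset of points. -/
def restr1 (M : Set (Sym2 α)) (R' : Set α) : Set (Sym2 α) :=
  {e ∈ M | ∀ x ∈ e, x ∈ R'}

/-- `M` is an `f`-minimal 1-colour matching of a (possibly infinite) set `R`. -/
def Min1 (f : ℝ → ℝ) (R : Set α) (M : Set (Sym2 α)) : Prop :=
  IsMatch1 R M ∧
  ∀ R' : Set α, R' ⊆ R → R'.Finite → Compat1 M R' → FinMin1 f R' (restr1 M R')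

/-- `(R', B')` is compatible with the 2-colour matching `M`. -/
def Compat2 (M : Set (α × α)) (R' B' : Set α) : Prop :=
  ∀ e ∈ M, (e.1 ∈ R' ∨ e.2 ∈ B') → (e.1 ∈ R' ∧ e.2 ∈ B')

/-- Restriction of a 2-colour matching. -/
def restr2 (M : Set (α × α)) (R' B' : Set α) : Set (α × α) :=
  {e ∈ M | e.1 ∈ R' ∧ e.2 ∈ B'}

/-- `M` is an `f`-minimal 2-colour matching of possibly infinite sets `R`, `B`. -/
def Min2 (f : ℝ → ℝ) (R B : Set α) (M : Set (α × α)) : Prop :=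
  IsMatch2 R B M ∧
  ∀ R' B' : Set α, R' ⊆ R → B' ⊆ B → R'.Finite → B'.Finite →
    Compat2 M R' B' → FinMin2 f R' B' (restr2 M R' B')

open Classical in
noncomputable def lens1 (M : Set (Sym2 α)) : Multiset ℝ :=
  if h : M.Finite then h.toFinset.val.map edgeLen else 0

open Classical in
noncomputable def lens2 (M : Set (α × α)) : Multiset ℝ :=
  if h : M.Finite then h.toFinset.val.map (fun e => dist e.1 e.2) else 0

/-- Increasing rearrangement of a multiset of reals, padded with `⊥ = -∞`. -/
noncomputable def incSeq (s : Multiset ℝ) : ℕ → EReal := fun n =>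
  ((s.sort (· ≤ ·)).map (fun x : ℝ => (x : EReal))).getD n ⊥

/-- Decreasing rearrangement of a multiset of reals, padded with `⊥ = -∞`. -/
noncomputable def decSeq (s : Multiset ℝ) : ℕ → EReal := fun n =>
  ((s.sort (· ≤ ·)).reverse.map (fun x : ℝ => (x : EReal))).getD n ⊥

/-- Lexicographic (non-strict) comparison of sequences. -/
def seqLex (a b : ℕ → EReal) : Prop :=
  a = b ∨ ∃ n : ℕ, (∀ m : ℕ, m < n → a m = b m) ∧ a n < b n

/-- Lexicographic comparison of (number of unmatched points, length sequence). -/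
def lexSeqLe (u : ℕ) (a : ℕ → EReal) (u' : ℕ) (b : ℕ → EReal) : Prop :=
  u < u' ∨ (u = u' ∧ seqLex a b)

/-- `M` is a `(-∞)`-minimal 1-colour matching of the finite set `R`. -/
def FinNegMin1 (R : Set α) (M : Set (Sym2 α)) : Prop :=
  IsMatch1 R M ∧ ∀ m : Set (Sym2 α), IsMatch1 R m →
    lexSeqLe (unm1 R M) (incSeq (lens1 M)) (unm1 R m) (incSeq (lens1 m))

/-- `M` is an `∞`-minimal 1-colour matching of the finite set `R`. -/
def FinPosMin1 (R : Set α) (M : Set (Sym2 α)) : Prop :=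
  IsMatch1 R M ∧ ∀ m : Set (Sym2 α), IsMatch1 R m →
    lexSeqLe (unm1 R M) (decSeq (lens1 M)) (unm1 R m) (decSeq (lens1 m))

/-- `M` is a `(-∞)`-minimal 2-colour matching of the finite sets `R`, `B`. -/
def FinNegMin2 (R B : Set α) (M : Set (α × α)) : Prop :=
  IsMatch2 R B M ∧ ∀ m : Set (α × α), IsMatch2 R B m →
    lexSeqLe (unm2 R B M) (incSeq (lens2 M)) (unm2 R B m) (incSeq (lens2 m))

/-- `M` is an `∞`-minimal 2-colour matching of the finite sets `R`, `B`. -/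
def FinPosMin2 (R B : Set α) (M : Set (α × α)) : Prop :=
  IsMatch2 R B M ∧ ∀ m : Set (α × α), IsMatch2 R B m →
    lexSeqLe (unm2 R B M) (decSeq (lens2 M)) (unm2 R B m) (decSeq (lens2 m))

/-- `M` is a `(-∞)`-minimal 1-colour matching of a (possibly infinite) set `R`. -/
def NegMin1 (R : Set α) (M : Set (Sym2 α)) : Prop :=
  IsMatch1 R M ∧
  ∀ R' : Set α, R' ⊆ R → R'.Finite → Compat1 M R' → FinNegMin1 R' (restr1 M R')

/-- `M` is a `(-∞)`-minimal 2-colour matching of possibly infinite `R`, `B`. -/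
def NegMin2 (R B : Set α) (M : Set (α × α)) : Prop :=
  IsMatch2 R B M ∧
  ∀ R' B' : Set α, R' ⊆ R → B' ⊆ B → R'.Finite → B'.Finite →
    Compat2 M R' B' → FinNegMin2 R' B' (restr2 M R' B')

/-- `x` lies strictly between `a` and `b`. -/
def btw (a b x : ℝ) : Prop := min a b < x ∧ x < max a b

/-- The four reals are pairwise distinct. -/
def distinct4 (a b c d : ℝ) : Prop :=
  a ≠ b ∧ a ≠ c ∧ a ≠ d ∧ b ≠ c ∧ b ≠ d ∧ c ≠ d

/-- The edges `{a,b}` and `{c,d}` are entwined. -/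
def EntwinedP (a b c d : ℝ) : Prop :=
  distinct4 a b c d ∧ Xor' (btw a b c) (btw a b d)

/-- The edge `{a,b}` straddles the edge `{c,d}`. -/
def StraddleP (a b c d : ℝ) : Prop := btw a b c ∧ btw a b d

/-- `M` is a `(1+)`-minimal 1-colour matching of a finite set `R ⊂ ℝ`. -/
def OnePlusMin1 (R : Set ℝ) (M : Set (Sym2 ℝ)) : Prop :=
  FinMin1 (fgam 1) R M ∧
  ∀ a b a' b' : ℝ, s(a, b) ∈ M → s(a', b') ∈ M → ¬ StraddleP a b a' b'

/-- `M` is a `(1-)`-minimal 1-colour matching of a finite set `R ⊂ ℝ`. -/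
def OneMinusMin1 (R : Set ℝ) (M : Set (Sym2 ℝ)) : Prop :=
  FinMin1 (fgam 1) R M ∧
  ∀ a b a' b' : ℝ, s(a, b) ∈ M → s(a', b') ∈ M → ¬ EntwinedP a b a' b'

/-- `M` is a `(1+)`-minimal 2-colour matching of finite sets `R, B ⊂ ℝ`. -/
def OnePlusMin2 (R B : Set ℝ) (M : Set (ℝ × ℝ)) : Prop :=
  FinMin2 (fgam 1) R B M ∧
  ∀ e ∈ M, ∀ e' ∈ M, ¬ StraddleP e.1 e.2 e'.1 e'.2

/-- `M` is a `(1-)`-minimal 2-colour matching of finite sets `R, B ⊂ ℝ`. -/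
def OneMinusMin2 (R B : Set ℝ) (M : Set (ℝ × ℝ)) : Prop :=
  FinMin2 (fgam 1) R B M ∧
  ∀ e ∈ M, ∀ e' ∈ M, ¬ EntwinedP e.1 e.2 e'.1 e'.2


noncomputable def gAux (x μ : ℝ) : ℝ := dslope (fun t : ℝ => x ^ t) 0 μ

lemma gAux_cont {x : ℝ} (hx : 0 < x) : Continuous (gAux x) := by
  have hd : Differentiable ℝ (fun t : ℝ => x ^ t) := fun t =>
    (Real.hasStrictDerivAt_const_rpow hx t).hasDerivAt.differentiableAt
  rw [continuous_iff_continuousAt]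
  intro μ
  by_cases h : μ = 0
  · subst h
    exact continuousAt_dslope_same.2 (hd 0)
  · exact (continuousAt_dslope_of_ne h).2 (hd μ).continuousAt

lemma gAux_ne {x μ : ℝ} (h : μ ≠ 0) : gAux x μ = (x ^ μ - 1) / μ := by
  unfold gAux
  rw [dslope_of_ne _ h, slope_def_field]
  simp

lemma gAux_zero {x : ℝ} (hx : 0 < x) : gAux x 0 = Real.log x := by
  unfold gAux
  rw [dslope_same, (Real.hasStrictDerivAt_const_rpow hx 0).hasDerivAt.deriv]
  simp

lemma fgam_aux (μ : ℝ) : ∃ a b : ℝ, 0 < a ∧ ∀ x : ℝ, 0 < x → fgam μ x = a * gAux x μ + b := by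
  rcases lt_trichotomy μ 0 with h | h | h
  · refine ⟨-μ, -1, by linarith, fun x hx => ?_⟩
    rw [gAux_ne h.ne, fgam, if_neg (by linarith), if_neg h.ne]
    have := h.ne
    field_simp
    ring
  · refine ⟨1, 0, one_pos, fun x hx => ?_⟩
    subst h
    simp [gAux_zero hx, fgam]
  · refine ⟨μ, 1, h, fun x hx => ?_⟩
    rw [gAux_ne h.ne', fgam, if_pos h]
    have := h.ne'
    field_simp
    ring

lemma cost_lt_iff {X : Type*} (len : X → ℝ) (μ : ℝ) (M m : Set X) (hM : M.Finite) (hm : m.Finite)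
    (pM : ∀ e ∈ M, 0 < len e) (pm : ∀ e ∈ m, 0 < len e) (hc : M.ncard = m.ncard) :
    (∑ᶠ e ∈ M, fgam μ (len e)) < (∑ᶠ e ∈ m, fgam μ (len e)) ↔
    (∑ e ∈ hM.toFinset, gAux (len e) μ) < (∑ e ∈ hm.toFinset, gAux (len e) μ) := by
  obtain ⟨a, b, ha, hab⟩ := fgam_aux μ
  have key : ∀ (s : Set X) (hs : s.Finite), (∀ e ∈ s, 0 < len e) →
      (∑ᶠ e ∈ s, fgam μ (len e)) = a * (∑ e ∈ hs.toFinset, gAux (len e) μ) + s.ncard * b := by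
    intro s hs ps
    rw [finsum_mem_eq_finite_toFinset_sum _ hs, Set.ncard_eq_toFinset_card s hs, Finset.mul_sum,
      ← nsmul_eq_mul, ← Finset.sum_const, ← Finset.sum_add_distrib]
    exact Finset.sum_congr rfl fun e he => hab _ (ps e (by simpa using he))
  rw [key M hM pM, key m hm pm, hc, add_lt_add_iff_right, mul_lt_mul_iff_right₀ ha]

lemma abstract_stab {X : Type*} (len : X → ℝ) (P : Set X → Prop) (u : Set X → ℕ)
    (hfin : {m | P m}.Finite) (hPf : ∀ m, P m → m.Finite)
    (hpos : ∀ m, P m → ∀ e ∈ m, 0 < len e)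
    (hu : ∀ m m', P m → P m' → u m = u m' → m.ncard = m'.ncard)
    (γ : ℝ) (M : Set X)
    (Q : ℝ → Set X → Prop)
    (hQ : ∀ μ M, Q μ M ↔ (P M ∧ ∀ m, P m →
      lexLe (u M) (∑ᶠ e ∈ M, fgam μ (len e)) (u m) (∑ᶠ e ∈ m, fgam μ (len e))))
    (h : Q γ M) (huniq : ∀ M', Q γ M' → M' = M) :
    ∃ ε : ℝ, 0 < ε ∧ ∀ μ : ℝ, |μ - γ| < ε → Q μ M ∧ ∀ M', Q μ M' → M' = M := by
  have h' := (hQ _ _).1 h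
  obtain ⟨hPM, hmin⟩ := h'
  have ev : ∀ᶠ μ in nhds γ, ∀ m ∈ {m | P m}, m ≠ M →
      (u M < u m ∨ (u M = u m ∧
        (∑ᶠ e ∈ M, fgam μ (len e)) < (∑ᶠ e ∈ m, fgam μ (len e)))) := by
    rw [Filter.eventually_all_finite hfin]
    intro m hm
    by_cases hne : m = M
    · exact Filter.Eventually.of_forall fun μ h => absurd hne h
    rcases hmin m hm with hlt | ⟨heq, hle⟩
    · exact Filter.Eventually.of_forall fun μ _ => Or.inl hlt
    have hlt : (∑ᶠ e ∈ M, fgam γ (len e)) < (∑ᶠ e ∈ m, fgam γ (len e)) := by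
      by_contra hcon
      push Not at hcon
      refine hne (huniq m ((hQ _ _).2 ⟨hm, fun m' hm' => ?_⟩))
      rcases hmin m' hm' with h1 | ⟨h1, h2⟩
      · left; omega
      · right; exact ⟨by omega, hcon.trans h2⟩
    have hc := hu M m hPM hm heq
    rw [cost_lt_iff len γ M m (hPf M hPM) (hPf m hm) (hpos M hPM) (hpos m hm) hc] at hlt
    have cont : ∀ (s : Set X) (hs : s.Finite), (∀ e ∈ s, 0 < len e) →
        Continuous (fun μ => ∑ e ∈ hs.toFinset, gAux (len e) μ) := by
      intro s hs ps
      exact continuous_finset_sum _ fun e he => gAux_cont (ps e (by simpa using he))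
    have := (cont M (hPf M hPM) (hpos M hPM)).continuousAt.eventually_lt
      (cont m (hPf m hm) (hpos m hm)).continuousAt hlt
    filter_upwards [this] with μ hμ _
    right
    exact ⟨heq, (cost_lt_iff len μ M m (hPf M hPM) (hPf m hm) (hpos M hPM) (hpos m hm) hc).2 hμ⟩
  obtain ⟨ε, hε, hb⟩ := Metric.eventually_nhds_iff.1 ev
  refine ⟨ε, hε, fun μ hμ => ?_⟩
  have hs := hb (y := μ) (by rwa [Real.dist_eq])
  refine ⟨(hQ _ _).2 ⟨hPM, fun m hm => ?_⟩, fun M' hM' => ?_⟩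
  · by_cases hne : m = M
    · subst hne; exact Or.inr ⟨rfl, le_rfl⟩
    · rcases hs m hm hne with h1 | ⟨h1, h2⟩
      · exact Or.inl h1
      · exact Or.inr ⟨h1, h2.le⟩
  · by_contra hne
    obtain ⟨hP', hm'⟩ := (hQ _ _).1 hM'
    rcases hs M' hP' hne with h1 | ⟨h1, h2⟩ <;> rcases hm' M hPM with h3 | ⟨h3, h4⟩
    · omega
    · omega
    · omega
    · linarith

lemma ncard_split {X : Type*} {R : Set X} (hR : R.Finite) (p : X → Prop) :
    {x ∈ R | p x}.ncard + {x ∈ R | ¬ p x}.ncard = R.ncard := by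
  rw [← Set.ncard_union_eq ?_ (hR.subset (Set.sep_subset _ _)) (hR.subset (Set.sep_subset _ _))]
  · congr 1
    ext x
    simp only [Set.mem_union, Set.mem_setOf_eq]
    tauto
  · rw [Set.disjoint_left]
    rintro x ⟨_, h1⟩ ⟨_, h2⟩
    exact h2 h1

lemma count2R {X : Type*} [MetricSpace X] {R B : Set X} (hR : R.Finite) {M : Set (X × X)}
    (hM : IsMatch2 R B M) : M.ncard + {x ∈ R | ¬ ∃ y, (x, y) ∈ M}.ncard = R.ncard := by
  rw [← ncard_split hR (fun x => ∃ y, (x, y) ∈ M)]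
  congr 1
  have : {x ∈ R | ∃ y, (x, y) ∈ M} = Prod.fst '' M := by
    ext x
    constructor
    · rintro ⟨_, y, h⟩; exact ⟨_, h, rfl⟩
    · rintro ⟨⟨x, y⟩, h, rfl⟩; exact ⟨(hM.1 _ h).1, y, h⟩
  rw [this, Set.ncard_image_of_injOn]
  rintro ⟨x, y⟩ h ⟨x', y'⟩ h' (rfl : x = x')
  rw [hM.2.1 _ _ _ h h']

lemma count2B {X : Type*} [MetricSpace X] {R B : Set X} (hB : B.Finite) {M : Set (X × X)}
    (hM : IsMatch2 R B M) : M.ncard + {y ∈ B | ¬ ∃ x, (x, y) ∈ M}.ncard = B.ncard := by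
  rw [← ncard_split hB (fun y => ∃ x, (x, y) ∈ M)]
  congr 1
  have : {y ∈ B | ∃ x, (x, y) ∈ M} = Prod.snd '' M := by
    ext x
    constructor
    · rintro ⟨_, y, h⟩; exact ⟨_, h, rfl⟩
    · rintro ⟨⟨x, y⟩, h, rfl⟩; exact ⟨(hM.1 _ h).2, x, h⟩
  rw [this, Set.ncard_image_of_injOn]
  rintro ⟨x, y⟩ h ⟨x', y'⟩ h' (rfl : y = y')
  rw [hM.2.2 _ _ _ h h']

lemma match1_sub {X : Type*} [MetricSpace X] {R : Set X} (hR : R.Finite) :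
    {e : Sym2 X | ∀ x ∈ e, x ∈ R}.Finite := by
  refine ((hR.prod hR).image (fun p : X × X => s(p.1, p.2))).subset ?_
  intro e he
  induction e using Sym2.ind with
  | _ x y => exact ⟨(x, y), ⟨he x (by simp), he y (by simp)⟩, rfl⟩

open Classical in
lemma count1 {X : Type*} [MetricSpace X] {R : Set X} (hR : R.Finite) {M : Set (Sym2 X)}
    (hM : IsMatch1 R M) : 2 * M.ncard + unm1 R M = R.ncard := by
  have hMf : M.Finite := (match1_sub hR).subset fun e he => (hM.1 e he).2
  rw [← ncard_split hR (fun x => matched1 M x)]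
  unfold unm1
  congr 1
  have : {x ∈ R | matched1 M x} = (hMf.toFinset.biUnion Sym2.toFinset : Finset X) := by
    ext x
    simp only [matched1, Set.mem_setOf_eq, Finset.coe_biUnion, Set.mem_iUnion, Finset.mem_coe,
      Sym2.mem_toFinset, Set.Finite.mem_toFinset, exists_prop]
    constructor
    · rintro ⟨_, h⟩; exact h
    · rintro ⟨e, h, hx⟩; exact ⟨(hM.1 e h).2 x hx, e, h, hx⟩
  rw [this, Set.ncard_coe_finset, Finset.card_biUnion]
  · rw [Finset.sum_congr rfl (g := fun _ => 2), Finset.sum_const, Set.ncard_eq_toFinset_card M hMf,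
      smul_eq_mul, mul_comm]
    intro e he
    exact Sym2.card_toFinset_of_not_isDiag e (hM.1 e (by simpa using he)).1
  · intro e he e' he' hne
    rw [Function.onFun, Finset.disjoint_left]
    intro x hx hx'
    exact hne (hM.2 e (by simpa using he) e' (by simpa using he') x (by simpa using hx)
      (by simpa using hx'))

/-- If `M` is the unique `γ`-minimal matching of fixed finite set(s), then for all
`μ` sufficiently close to `γ`, `M` is the unique `μ`-minimal matching
(1-colour and 2-colour cases). -/
theorem stmt_5 (d : ℕ) (hd : 1 ≤ d) (γ : ℝ)
    (R B : Set (EuclideanSpace ℝ (Fin d))) (hR : R.Finite) (hB : B.Finite)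
    (hRB : Disjoint R B) :
    (∀ M : Set (Sym2 (EuclideanSpace ℝ (Fin d))),
      FinMin1 (fgam γ) R M → (∀ M', FinMin1 (fgam γ) R M' → M' = M) →
      ∃ ε : ℝ, 0 < ε ∧ ∀ μ : ℝ, |μ - γ| < ε →
        FinMin1 (fgam μ) R M ∧ ∀ M', FinMin1 (fgam μ) R M' → M' = M) ∧
    (∀ M : Set (EuclideanSpace ℝ (Fin d) × EuclideanSpace ℝ (Fin d)),
      FinMin2 (fgam γ) R B M → (∀ M', FinMin2 (fgam γ) R B M' → M' = M) →
      ∃ ε : ℝ, 0 < ε ∧ ∀ μ : ℝ, |μ - γ| < ε →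
        FinMin2 (fgam μ) R B M ∧ ∀ M', FinMin2 (fgam μ) R B M' → M' = M) := by
  constructor
  · intro M hM hu
    refine abstract_stab edgeLen (IsMatch1 R) (unm1 R) ?_ ?_ ?_ ?_ γ M
      (fun μ => FinMin1 (fgam μ) R) (fun μ M => Iff.rfl) hM hu
    · refine (match1_sub hR).finite_subsets.subset ?_
      intro m hm e he
      exact (hm.1 e he).2
    · intro m hm
      exact (match1_sub hR).subset fun e he => (hm.1 e he).2
    · intro m hm e he
      have := (hm.1 e he).1
      induction e using Sym2.ind with
      | _ x y =>
        rw [Sym2.mk_isDiag_iff] at this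
        exact dist_pos.2 this
    · intro m m' hm hm' h
      have h1 := count1 hR hm
      have h2 := count1 hR hm'
      omega
  · intro M hM hu
    refine abstract_stab (fun e => dist e.1 e.2) (IsMatch2 R B) (unm2 R B) ?_ ?_ ?_ ?_ γ M
      (fun μ => FinMin2 (fgam μ) R B) (fun μ M => Iff.rfl) hM hu
    · refine (hR.prod hB).finite_subsets.subset ?_
      intro m hm e he
      exact hm.1 e he
    · intro m hm
      exact (hR.prod hB).subset fun e he => hm.1 e he
    · intro m hm e he
      have := hm.1 e he
      refine dist_pos.2 fun h => ?_
      exact Set.disjoint_left.1 hRB this.1 (h ▸ this.2)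
    · intro m m' hm hm' h
      have h1 := count2R hR hm
      have h2 := count2R hR hm'
      have h3 := count2B hB hm
      have h4 := count2B hB hm'
      unfold unm2 at h
      omega
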